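/- Let n, p be positive integers, let l : ℝᵖ → ℝⁿ be continuously differentiable with Jacobian J(θ) (an n×p matrix), and define the loss L(θ) = (1/(2n))‖l(θ)‖² and the kernel K(θ) = J(θ) J(θ)ᵀ. Let θ : [0,T] → ℝᵖ be a solution of the gradient flow θ'(t) = −∇L(θ(t)), set λ = λ_min(K(θ(0))), and suppose that for all t ∈ [0,T] the Frobenius norm satisfies ‖K(θ(t)) − K(θ(0))‖_F ≤ λ/2. Then for all t ∈ [0,T], L(θ(t)) ≤ L(θ(0)) · exp(−λ t / n). -/

import Mathlib

open Matrix

/-- The smallest eigenvalue of a real symmetric matrix, characterized as the infimum of the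
Rayleigh quotient `xᵀ A x` over unit vectors `x`. -/
noncomputable def lambdaMin {n : ℕ} (A : Matrix (Fin n) (Fin n) ℝ) : ℝ :=
  sInf {r : ℝ | ∃ x : Fin n → ℝ, (∑ i, x i ^ 2) = 1 ∧ r = x ⬝ᵥ A.mulVec x}

/-- The Frobenius norm of a real matrix. -/
noncomputable def frobeniusNorm' {n m : ℕ} (M : Matrix (Fin n) (Fin m) ℝ) : ℝ :=
  Real.sqrt (∑ i, ∑ j, (M i j) ^ 2)

/-- The Rayleigh quotient bound `λ_min(A) ‖y‖² ≤ yᵀ A y` for a positive semidefinite form. -/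
theorem lambdaMin_mul_dotProduct_self_le {n : ℕ} {A : Matrix (Fin n) (Fin n) ℝ}
    (hA : ∀ x, 0 ≤ x ⬝ᵥ A *ᵥ x) (y : Fin n → ℝ) :
    lambdaMin A * (y ⬝ᵥ y) ≤ y ⬝ᵥ A *ᵥ y := by
  rcases eq_or_ne y 0 with rfl | hy
  · simp
  have hpos : 0 < y ⬝ᵥ y := by
    refine lt_of_le_of_ne (Finset.sum_nonneg fun i _ => mul_self_nonneg (y i)) ?_
    exact fun h => hy (dotProduct_self_eq_zero.mp h.symm)
  set s := √(y ⬝ᵥ y) with hs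
  have hss : s * s = y ⬝ᵥ y := Real.mul_self_sqrt hpos.le
  have hs0 : s ≠ 0 := (Real.sqrt_pos.mpr hpos).ne'
  have hle : lambdaMin A ≤ s⁻¹ * (s⁻¹ * (y ⬝ᵥ A *ᵥ y)) := by
    refine csInf_le ⟨0, ?_⟩ ⟨s⁻¹ • y, ?_, ?_⟩
    · rintro r ⟨x, -, rfl⟩
      exact hA x
    · have : ∑ i, (s⁻¹ • y) i ^ 2 = s⁻¹ * s⁻¹ * (y ⬝ᵥ y) := by
        simp only [Pi.smul_apply, smul_eq_mul, dotProduct, Finset.mul_sum]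
        exact Finset.sum_congr rfl fun i _ => by ring
      rw [this, ← hss]
      field_simp
    · simp [mulVec_smul, smul_dotProduct, dotProduct_smul]
  calc lambdaMin A * (y ⬝ᵥ y)
      ≤ s⁻¹ * (s⁻¹ * (y ⬝ᵥ A *ᵥ y)) * (y ⬝ᵥ y) := by gcongr
    _ = y ⬝ᵥ A *ᵥ y := by rw [← hss]; field_simp

/-- The quadratic form of a matrix is bounded by its Frobenius norm. -/
theorem abs_dotProduct_mulVec_le_frobeniusNorm' {n : ℕ} (M : Matrix (Fin n) (Fin n) ℝ)
    (y : Fin n → ℝ) : |y ⬝ᵥ M *ᵥ y| ≤ frobeniusNorm' M * (y ⬝ᵥ y) := by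
  have hy : 0 ≤ y ⬝ᵥ y := Finset.sum_nonneg fun i _ => mul_self_nonneg (y i)
  have hform : y ⬝ᵥ M *ᵥ y = ∑ q : Fin n × Fin n, M q.1 q.2 * (y q.1 * y q.2) := by
    simp only [dotProduct, mulVec, Finset.mul_sum, Fintype.sum_prod_type]
    exact Finset.sum_congr rfl fun i _ => Finset.sum_congr rfl fun j _ => by ring
  have hsq : ∑ q : Fin n × Fin n, (y q.1 * y q.2) ^ 2 = (y ⬝ᵥ y) ^ 2 := by
    simp only [dotProduct, Fintype.sum_prod_type, sq (∑ i, y i * y i), Finset.sum_mul_sum]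
    exact Finset.sum_congr rfl fun i _ => Finset.sum_congr rfl fun j _ => by ring
  have hfrob : frobeniusNorm' M ^ 2 = ∑ q : Fin n × Fin n, M q.1 q.2 ^ 2 := by
    rw [frobeniusNorm', Real.sq_sqrt (by positivity), Fintype.sum_prod_type]
  refine abs_le_of_sq_le_sq ?_ (mul_nonneg (Real.sqrt_nonneg _) hy)
  rw [mul_pow, hfrob, ← hsq, hform]
  exact Finset.sum_mul_sq_le_sq_mul_sq _ _ _

/-- The quadratic form of `B Bᵀ` is `‖Bᵀ y‖²`. -/
theorem dotProduct_mul_transpose_mulVec {n p : ℕ} (B : Matrix (Fin n) (Fin p) ℝ)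
    (y : Fin n → ℝ) : y ⬝ᵥ (B * Bᵀ) *ᵥ y = (Bᵀ *ᵥ y) ⬝ᵥ (Bᵀ *ᵥ y) := by
  rw [← mulVec_mulVec, dotProduct_mulVec, mulVec_transpose]

/-- If `B Bᵀ` is within Frobenius distance `λ_min(A Aᵀ) / 2` of `A Aᵀ`, then
`λ_min(A Aᵀ) / 2` bounds the quadratic form of `B Bᵀ` from below. -/
theorem half_lambdaMin_mul_le_of_frobeniusNorm'_le {n p : ℕ} {A B : Matrix (Fin n) (Fin p) ℝ}
    (h : frobeniusNorm' (B * Bᵀ - A * Aᵀ) ≤ lambdaMin (A * Aᵀ) / 2) (y : Fin n → ℝ) :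
    lambdaMin (A * Aᵀ) / 2 * (y ⬝ᵥ y) ≤ (Bᵀ *ᵥ y) ⬝ᵥ (Bᵀ *ᵥ y) := by
  have hsq {m : ℕ} (z : Fin m → ℝ) : 0 ≤ z ⬝ᵥ z :=
    Finset.sum_nonneg fun i _ => mul_self_nonneg (z i)
  have hA := lambdaMin_mul_dotProduct_self_le (A := A * Aᵀ)
    (fun x => by rw [dotProduct_mul_transpose_mulVec]; exact hsq _) y
  have hdiff := (abs_le.mp (abs_dotProduct_mulVec_le_frobeniusNorm' (B * Bᵀ - A * Aᵀ) y)).1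
  rw [sub_mulVec, dotProduct_sub, dotProduct_mul_transpose_mulVec B] at hdiff
  linarith [mul_le_mul_of_nonneg_right h (hsq y)]

/-- The gradient of the least squares loss `‖l‖² / (2n)` is `Jᵀ l / n`. -/
theorem hasGradientAt_half_mean_norm_sq {n p : ℕ}
    {l : EuclideanSpace ℝ (Fin p) → EuclideanSpace ℝ (Fin n)}
    {B : Matrix (Fin n) (Fin p) ℝ} {x : EuclideanSpace ℝ (Fin p)}
    (hl : HasFDerivAt l (Matrix.toEuclideanLin B).toContinuousLinearMap x) :
    HasGradientAt (fun z => 1 / (2 * (n : ℝ)) * ‖l z‖ ^ 2)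
      ((n : ℝ)⁻¹ • WithLp.toLp 2 (Bᵀ *ᵥ (l x).ofLp)) x := by
  rw [hasGradientAt_iff_hasFDerivAt]
  refine (hl.norm_sq.const_mul (1 / (2 * (n : ℝ)))).congr_fderiv ?_
  ext v
  simp [EuclideanSpace.inner_eq_star_dotProduct, mulVec_transpose,
    dotProduct_comm _ (l x).ofLp, dotProduct_comm v.ofLp, dotProduct_mulVec]
  ring

/-- A function on `[0, T]` with `f' ≤ -c f` decays at least like `exp (-c t)`. -/
theorem le_mul_exp_of_hasDerivAt_le {f f' : ℝ → ℝ} {c T : ℝ}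
    (hf : ∀ t ∈ Set.Icc 0 T, HasDerivAt f (f' t) t)
    (hle : ∀ t ∈ Set.Icc 0 T, f' t ≤ -c * f t) {t : ℝ} (ht : t ∈ Set.Icc 0 T) :
    f t ≤ f 0 * Real.exp (-c * t) := by
  have hderiv : ∀ s ∈ Set.Icc 0 T, HasDerivAt (fun s => f s * Real.exp (c * s))
      (f' s * Real.exp (c * s) + f s * (Real.exp (c * s) * c)) s := fun s hs =>
    (hf s hs).mul (by simpa using ((hasDerivAt_id s).const_mul c).exp)
  have hanti : AntitoneOn (fun s => f s * Real.exp (c * s)) (Set.Icc 0 T) := by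
    refine antitoneOn_of_hasDerivWithinAt_nonpos (convex_Icc 0 T)
      (fun s hs => (hderiv s hs).continuousAt.continuousWithinAt)
      (fun s hs => (hderiv s (interior_subset hs)).hasDerivWithinAt) fun s hs => ?_
    nlinarith [hle s (interior_subset hs), Real.exp_pos (c * s)]
  have h := hanti ⟨le_rfl, ht.1.trans ht.2⟩ ht ht.1
  simp only [mul_zero, Real.exp_zero, mul_one] at h
  calc f t = f t * Real.exp (c * t) * Real.exp (-c * t) := by
        rw [mul_assoc, ← Real.exp_add]; simp
    _ ≤ f 0 * Real.exp (-c * t) := by gcongr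

/-- Exponential decay of the loss `L(θ) = ‖l(θ)‖²/(2n)` along the gradient flow
`θ' = −∇L(θ)`, as long as the kernel `K(θ) = J(θ)J(θ)ᵀ` stays within Frobenius distance
`λ_min(K(θ(0)))/2` of its initial value. -/
theorem loss_exponential_decay {n p : ℕ} (hn : 0 < n) (hp : 0 < p)
    (l : EuclideanSpace ℝ (Fin p) → EuclideanSpace ℝ (Fin n))
    (J : EuclideanSpace ℝ (Fin p) → Matrix (Fin n) (Fin p) ℝ)
    (hJ : ∀ x, HasFDerivAt l ((Matrix.toEuclideanLin (J x)).toContinuousLinearMap) x)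
    (hJcont : Continuous J)
    (L : EuclideanSpace ℝ (Fin p) → ℝ)
    (hL : ∀ x, L x = (1 / (2 * (n : ℝ))) * ‖l x‖ ^ 2)
    (T : ℝ) (hT : 0 ≤ T)
    (θ : ℝ → EuclideanSpace ℝ (Fin p))
    (hflow : ∀ t ∈ Set.Icc (0 : ℝ) T, HasDerivAt θ (-(gradient L (θ t))) t)
    (hK : ∀ t ∈ Set.Icc (0 : ℝ) T,
      frobeniusNorm' (J (θ t) * (J (θ t))ᵀ - J (θ 0) * (J (θ 0))ᵀ)
        ≤ lambdaMin (J (θ 0) * (J (θ 0))ᵀ) / 2) :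
    ∀ t ∈ Set.Icc (0 : ℝ) T,
      L (θ t) ≤ L (θ 0) * Real.exp (-(lambdaMin (J (θ 0) * (J (θ 0))ᵀ)) * t / n) := by
  have hLfun : L = fun z => 1 / (2 * (n : ℝ)) * ‖l z‖ ^ 2 := funext hL
  have hgrad : ∀ x, HasGradientAt L ((n : ℝ)⁻¹ • WithLp.toLp 2 ((J x)ᵀ *ᵥ (l x).ofLp)) x :=
    fun x => hLfun ▸ hasGradientAt_half_mean_norm_sq (hJ x)
  have hn' : (0 : ℝ) < n := by exact_mod_cast hn
  have hderiv : ∀ t ∈ Set.Icc (0 : ℝ) T,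
      HasDerivAt (fun s => L (θ s)) (-‖gradient L (θ t)‖ ^ 2) t := fun t ht => by
    have h := (hgrad (θ t)).differentiableAt.hasGradientAt.hasFDerivAt.comp_hasDerivAt t
      (hflow t ht)
    rw [map_neg, InnerProductSpace.toDual_apply_apply, real_inner_self_eq_norm_sq] at h
    exact h
  intro t ht
  rw [show -lambdaMin (J (θ 0) * (J (θ 0))ᵀ) * t / n =
    -(lambdaMin (J (θ 0) * (J (θ 0))ᵀ) / n) * t by ring]
  refine le_mul_exp_of_hasDerivAt_le hderiv (fun s hs => ?_) ht
  have hnorm {m : ℕ} (v : EuclideanSpace ℝ (Fin m)) : ‖v‖ ^ 2 = v.ofLp ⬝ᵥ v.ofLp := by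
    rw [EuclideanSpace.real_norm_sq_eq]
    simp [dotProduct, sq]
  have hbound := half_lambdaMin_mul_le_of_frobeniusNorm'_le (hK s hs) (l (θ s)).ofLp
  rw [(hgrad (θ s)).gradient, norm_smul, mul_pow, hnorm, hL, hnorm, Real.norm_eq_abs, sq_abs]
  have hmul := mul_le_mul_of_nonneg_left hbound (sq_nonneg (n : ℝ)⁻¹)
  calc _ ≤ -((n : ℝ)⁻¹ ^ 2 * (lambdaMin (J (θ 0) * (J (θ 0))ᵀ) / 2 *
          ((l (θ s)).ofLp ⬝ᵥ (l (θ s)).ofLp))) := neg_le_neg hmul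
    _ = _ := by field_simp
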